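/- arXiv:1507.05309 — 9 statements merged into one kernel-verified Lean document; each statement's English description precedes it below -/
import Mathlib

section
/- Let G be a finite group such that every proper subgroup of G is abelian (commutative). Then G is solvable. -/
/-- If the normalizer of a Sylow subgroup `P` is abelian, then `N(P)` centralizes `P`. -/
theorem Sylow.normalizer_le_centralizer_of_commute {G : Type*} [Group G] {p : ℕ} (P : Sylow p G)
    (h : ∀ x y : G, x ∈ Subgroup.normalizer (P : Set G) → y ∈ Subgroup.normalizer (P : Set G) →
      x * y = y * x) :
    Subgroup.normalizer (P : Set G) ≤ Subgroup.centralizer (P : Set G) := fun x hx =>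
  Subgroup.mem_centralizer_iff.mpr fun y hy => h y x (Subgroup.le_normalizer hy) hx

/-- Miller's theorem: a finite group all of whose proper subgroups are
abelian is solvable. -/
theorem solvable_of_proper_subgroups_abelian (G : Type*) [Group G] [Finite G]
    (h : ∀ H : Subgroup G, H ≠ ⊤ → ∀ x y : G, x ∈ H → y ∈ H → x * y = y * x) :
    IsSolvable G := by
  change Group.IsSolvable G
  have solvable_of_ne_top (H : Subgroup G) (hH : H ≠ ⊤) : Group.IsSolvable H :=
    Group.isSolvable_of_comm fun a b => Subtype.ext (h H hH a b a.2 b.2)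
  by_cases hN : ∀ (p : ℕ) (_ : Fact p.Prime) (P : Sylow p G), (P : Subgroup G).Normal
  · have : Group.IsNilpotent G := ((Group.isNilpotent_of_finite_tfae (G := G)).out 0 3).mpr hN
    infer_instance
  · push Not at hN
    obtain ⟨p, _, P, hP⟩ := hN
    have hP_top : (P : Subgroup G) ≠ ⊤ := fun e => hP (e ▸ inferInstance)
    have hP_bot : (P : Subgroup G) ≠ ⊥ := fun e => hP (e ▸ inferInstance)
    have hNC := P.normalizer_le_centralizer_of_commute
      (h _ fun e => hP (Subgroup.normalizer_eq_top_iff.mp e))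
    let f := MonoidHom.transferSylow P hNC
    have hker : f.ker ≠ ⊤ := fun e => hP_bot <| by
      simpa [f, e, Subgroup.isComplement'_top_left] using
        MonoidHom.ker_transferSylow_isComplement' P hNC
    have := solvable_of_ne_top _ hP_top
    have := solvable_of_ne_top _ hker
    exact Group.isSolvable_of_ker_le_range f.ker.subtype f f.ker.range_subtype.ge
end

section
/- Let G be a finite simple group all of whose proper subgroups are abelian (commutative). Then G is abelian. Equivalently: a nonabelian finite simple group must contain a nonabelian proper subgroup. -/
/-- A finite simple group all of whose proper subgroups are abelian is itself
abelian. -/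
theorem comm_of_simple_of_proper_subgroups_abelian (G : Type*) [Group G] [Finite G]
    (hs : IsSimpleGroup G)
    (h : ∀ H : Subgroup G, H ≠ ⊤ → ∀ x y : G, x ∈ H → y ∈ H → x * y = y * x) :
    ∀ a b : G, a * b = b * a := by
  obtain ⟨p, hp, hpG⟩ := Nat.exists_prime_and_dvd (Finite.one_lt_card (α := G)).ne'
  have : Fact p.Prime := ⟨hp⟩
  obtain ⟨P⟩ : Nonempty (Sylow p G) := inferInstance
  have hbot : (P : Subgroup G) ≠ ⊥ := P.ne_bot_of_dvd_card hpG
  by_cases htop : (P : Subgroup G) = ⊤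
  · have hG : IsPGroup p G := fun g ↦ by
      obtain ⟨k, hk⟩ := P.isPGroup' ⟨g, htop ▸ Subgroup.mem_top g⟩
      exact ⟨k, by simpa using congrArg Subtype.val hk⟩
    have : Nontrivial (Subgroup.center G) := hG.center_nontrivial
    have hc : Subgroup.center G = ⊤ :=
      (inferInstance : (Subgroup.center G).Normal).eq_bot_or_eq_top.resolve_left
        ((Subgroup.nontrivial_iff_ne_bot _).mp this)
    intro a b
    exact (Subgroup.mem_center_iff.mp (hc ▸ Subgroup.mem_top b : b ∈ Subgroup.center G)) a
  · have hN : Subgroup.normalizer (P : Set G) ≠ ⊤ := fun hN ↦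
      (Subgroup.normalizer_eq_top_iff.mp hN).eq_bot_or_eq_top.elim hbot htop
    have hC : Subgroup.normalizer (P : Set G) ≤ Subgroup.centralizer (P : Set G) :=
      fun x hx ↦ Subgroup.mem_centralizer_iff.mpr fun y hy ↦
        h _ hN y x (Subgroup.le_normalizer hy) hx
    have hK := MonoidHom.ker_transferSylow_isComplement' P hC
    rcases (MonoidHom.normal_ker (MonoidHom.transferSylow P hC)).eq_bot_or_eq_top with hk | hk
    · rw [hk] at hK
      exact absurd (Subgroup.isComplement'_bot_left.mp hK) htop
    · rw [hk] at hK
      exact absurd (Subgroup.isComplement'_top_left.mp hK) hbot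
end

section
/- Let R be a Henselian local ring whose residue field is separably closed (i.e., R is strictly Henselian). Let A and B be commutative local R-algebras such that A is finitely generated as an R-module and the structure homomorphism R → B is a local ring homomorphism (the maximal ideal of B lies over the maximal ideal of R). Then the tensor product A ⊗_R B is a local ring. -/
open TensorProduct

/-- A surjective ring homomorphism whose kernel lies in the Jacobson radical is local. -/
theorem RingHom.isLocalHom_of_surjective_of_ker_le_jacobson {S T : Type*} [CommRing S] [CommRing T]
    (f : S →+* T) (hf : Function.Surjective f) (hker : RingHom.ker f ≤ Ideal.jacobson ⊥) :
    IsLocalHom f where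
  map_nonunit a ha := by
    obtain ⟨c, hc⟩ := ha.exists_right_inv
    obtain ⟨b, rfl⟩ := hf c
    refine isUnit_of_mul_isUnit_left (y := b) (Ideal.isUnit_of_sub_one_mem_jacobson_bot _ (hker ?_))
    simp [RingHom.mem_ker, hc]

/-- The tensor product of a purely inseparable field extension with any field extension is a
local ring. -/
theorem IsPurelyInseparable.isLocalRing_tensorProduct (k K L : Type*) [Field k] [Field K] [Field L]
    [Algebra k K] [Algebra k L] [IsPurelyInseparable k K] : IsLocalRing (K ⊗[k] L) := by
  have hinj := (PrimeSpectrum.isHomeomorph_comap_of_isPurelyInseparable k K L).injective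
  have : IsLocalRing (L ⊗[k] K) := by
    obtain ⟨M, hM⟩ := Ideal.exists_maximal (L ⊗[k] K)
    refine IsLocalRing.of_unique_max_ideal ⟨M, hM, fun N hN ↦ ?_⟩
    exact congrArg PrimeSpectrum.asIdeal
      (hinj (Subsingleton.elim _ _) : (⟨N, hN.isPrime⟩ : PrimeSpectrum _) = ⟨M, hM.isPrime⟩)
  exact (Algebra.TensorProduct.comm k L K).toRingEquiv.isLocalRing

/-- If a local ring `A` is integral over a local ring `R`, then the structure map is local. -/
theorem IsLocalRing.isLocalHom_algebraMap_of_isIntegral (R A : Type*) [CommRing R] [CommRing A]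
    [Algebra R A] [IsLocalRing R] [IsLocalRing A] [Algebra.IsIntegral R A] :
    IsLocalHom (algebraMap R A) := by
  refine ((IsLocalRing.local_hom_TFAE (algebraMap R A)).out 0 4).mpr ?_
  exact IsLocalRing.eq_maximalIdeal
    (Ideal.isMaximal_comap_of_isIntegral_of_isMaximal (R := R) (maximalIdeal A))

open IsLocalRing Algebra.TensorProduct in
/-- Let `A` and `B` be local algebras over a local ring `R`, with `A` integral over `R` and `B` a
local `R`-algebra. Then the maximal ideals of `A` and `B` are contained in every maximal ideal of
`A ⊗[R] B`. -/
theorem IsLocalRing.map_maximalIdeal_sup_le_jacobson_tensorProduct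
    (R A B : Type*) [CommRing R] [CommRing A] [CommRing B] [Algebra R A] [Algebra R B]
    [IsLocalRing R] [IsLocalRing A] [IsLocalRing B] [Algebra.IsIntegral R A]
    [IsLocalHom (algebraMap R B)] :
    (maximalIdeal A).map (includeLeft : A →ₐ[R] A ⊗[R] B) ⊔
      (maximalIdeal B).map (includeRight : B →ₐ[R] A ⊗[R] B) ≤ Ideal.jacobson ⊥ := by
  refine le_sInf fun M ⟨_, hM⟩ ↦ ?_
  have hB : M.comap (includeRight : B →ₐ[R] A ⊗[R] B) = maximalIdeal B := by
    have hint : (includeRight : B →ₐ[R] A ⊗[R] B).toRingHom.IsIntegral := by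
      have : (includeRight : B →ₐ[R] A ⊗[R] B).toRingHom =
          (Algebra.TensorProduct.comm R B A).toRingHom.comp (algebraMap B (B ⊗[R] A)) := by
        ext; simp [Algebra.TensorProduct.algebraMap_apply]
      rw [this]
      exact RingHom.IsIntegral.trans _ _ (Algebra.IsIntegral.isIntegral (R := B))
        (RingHom.isIntegral_of_surjective _ (Algebra.TensorProduct.comm R B A).surjective)
    exact eq_maximalIdeal (Ideal.isMaximal_comap_of_isIntegral_of_isMaximal' _ hint M)
  have hA : M.comap (includeLeft : A →ₐ[R] A ⊗[R] B) = maximalIdeal A := by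
    have hR : (M.comap (includeLeft : A →ₐ[R] A ⊗[R] B)).comap (algebraMap R A) =
        maximalIdeal R := by
      have hRB : (maximalIdeal B).comap (algebraMap R B) = maximalIdeal R :=
        ((local_hom_TFAE (algebraMap R B)).out 0 4).mp ‹IsLocalHom (algebraMap R B)›
      rw [← hRB, ← hB]
      ext x
      simp only [Ideal.mem_comap, AlgHom.commutes]
    have : (M.comap (includeLeft : A →ₐ[R] A ⊗[R] B)).IsPrime := Ideal.comap_isPrime _ _
    refine eq_maximalIdeal (Ideal.isMaximal_of_isIntegral_of_isMaximal_comap (R := R) _ ?_)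
    rw [hR]
    infer_instance
  exact sup_le (Ideal.map_le_iff_le_comap.mpr hA.ge) (Ideal.map_le_iff_le_comap.mpr hB.ge)

open IsLocalRing in
/-- The tensor product `A ⊗[R] B` of local algebras over a local ring `R`, with `A` integral over
`R` and `B` a local `R`-algebra, is local as soon as the tensor product of the residue fields is. -/
theorem IsLocalRing.tensorProduct_of_residueField
    (R A B : Type*) [CommRing R] [CommRing A] [CommRing B] [Algebra R A] [Algebra R B]
    [IsLocalRing R] [IsLocalRing A] [IsLocalRing B] [Algebra.IsIntegral R A]
    [IsLocalHom (algebraMap R A)] [IsLocalHom (algebraMap R B)]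
    [IsLocalRing (ResidueField A ⊗[ResidueField R] ResidueField B)] :
    IsLocalRing (A ⊗[R] B) := by
  have : CompatibleSMul R (ResidueField R) (ResidueField A) (ResidueField B) :=
    .of_algebraMap_surjective _ _ residue_surjective
  have : IsLocalRing (ResidueField A ⊗[R] ResidueField B) :=
    (Algebra.TensorProduct.equivOfCompatibleSMul R (ResidueField R) R
      (ResidueField A) (ResidueField B)).toRingEquiv.isLocalRing
  let gA : A →ₐ[R] ResidueField A := IsScalarTower.toAlgHom R A (ResidueField A)
  let gB : B →ₐ[R] ResidueField B := IsScalarTower.toAlgHom R B (ResidueField B)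
  have hgA : Function.Surjective gA := residue_surjective
  have hgB : Function.Surjective gB := residue_surjective
  have hkA : RingHom.ker gA = maximalIdeal A := ker_residue
  have hkB : RingHom.ker gB = maximalIdeal B := ker_residue
  let f := (Algebra.TensorProduct.map gA gB).toRingHom
  have : IsLocalHom f := by
    refine f.isLocalHom_of_surjective_of_ker_le_jacobson
      (Algebra.TensorProduct.map_surjective _ _ hgA hgB) ?_
    refine (Algebra.TensorProduct.map_ker gA gB hgA hgB).trans_le ?_
    rw [hkA, hkB]
    exact map_maximalIdeal_sup_le_jacobson_tensorProduct R A B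
  exact f.domain_isLocalRing

/-- Over a strictly Henselian local ring `R`, the tensor product of a finite
local `R`-algebra `A` with a local `R`-algebra `B` whose maximal ideal lies
over that of `R` is a local ring. -/
theorem isLocalRing_tensorProduct_of_strictlyHenselian
    (R A B : Type*) [CommRing R] [HenselianLocalRing R]
    [IsSepClosed (IsLocalRing.ResidueField R)]
    [CommRing A] [CommRing B] [Algebra R A] [Algebra R B]
    [IsLocalRing A] [IsLocalRing B] [Module.Finite R A]
    [IsLocalHom (algebraMap R B)] :
    IsLocalRing (A ⊗[R] B) := by
  have := IsLocalRing.isLocalHom_algebraMap_of_isIntegral R A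
  have := IsPurelyInseparable.isLocalRing_tensorProduct (IsLocalRing.ResidueField R)
    (IsLocalRing.ResidueField A) (IsLocalRing.ResidueField B)
  exact IsLocalRing.tensorProduct_of_residueField R A B
end

section
/- Let R be a Henselian local ring and A a commutative R-algebra that is finitely generated as an R-module. Then A has only finitely many maximal ideals, and the canonical ring homomorphism from A to the product, over all maximal ideals m of A, of the localizations A_m is bijective. In particular A is a finite product of local rings. -/
open scoped TensorProduct

/-- Over a Henselian local ring `R`, a root in the residue field defined by a standard étale pair
lifts to such a root in `R`. -/
theorem StandardEtalePair.exists_algHom_of_henselian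
    {R k : Type*} [CommRing R] [HenselianLocalRing R] [Field k] [Algebra R k]
    (hk : Function.Surjective (algebraMap R k)) (P : StandardEtalePair R)
    (x : k) (hx : P.HasMap x) :
    ∃ a : R, P.HasMap a ∧ algebraMap R k a = x := by
  obtain ⟨a₀, rfl⟩ := hk x
  have hm : RingHom.ker (algebraMap R k) = IsLocalRing.maximalIdeal R :=
    IsLocalRing.ker_eq_maximalIdeal _ hk
  have hunit {r : R} (hr : IsUnit (algebraMap R k r)) : IsUnit r := by
    rw [← IsLocalRing.notMem_maximalIdeal, ← hm, RingHom.mem_ker]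
    exact hr.ne_zero
  have hf : P.f.eval a₀ ∈ IsLocalRing.maximalIdeal R := by
    rw [← hm, RingHom.mem_ker, ← Polynomial.aeval_algebraMap_apply_eq_algebraMap_eval]
    exact hx.1
  have hf' : IsUnit (P.f.derivative.eval a₀) := by
    apply hunit
    rw [← Polynomial.aeval_algebraMap_apply_eq_algebraMap_eval]
    exact hx.isUnit_derivative_f
  obtain ⟨a, ha, haa₀⟩ := HenselianLocalRing.is_henselian P.f P.monic_f a₀ hf hf'
  rw [← hm, RingHom.mem_ker, map_sub, sub_eq_zero] at haa₀
  refine ⟨a, ⟨by simpa using ha, ?_⟩, haa₀⟩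
  rw [Polynomial.coe_aeval_eq_eval]
  apply hunit
  rw [← Polynomial.aeval_algebraMap_apply_eq_algebraMap_eval, haa₀]
  exact hx.2

/-- An étale algebra over a Henselian local ring lifts its points over a residue field
of the base to sections. -/
theorem Algebra.Etale.exists_algHom_of_henselian
    {R S k : Type*} [CommRing R] [HenselianLocalRing R] [CommRing S] [Algebra R S]
    [Algebra.Etale R S] [Field k] [Algebra R k]
    (hk : Function.Surjective (algebraMap R k)) (π : S →ₐ[R] k) :
    ∃ φ : S →ₐ[R] R, (Algebra.ofId R k).comp φ = π := by
  have hQ : (RingHom.ker π).IsPrime := RingHom.ker_isPrime _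
  obtain ⟨f, hfQ, ⟨⟨P⟩⟩⟩ := Algebra.IsEtaleAt.exists_isStandardEtale (R := R) (RingHom.ker π)
  have hf : IsUnit (π f) := isUnit_iff_ne_zero.mpr hfQ
  let π' : Localization.Away f →ₐ[R] k := IsLocalization.Away.liftAlgHom f (f := π) hf
  obtain ⟨a, ha, hax⟩ := P.P.exists_algHom_of_henselian hk (π' P.x) (P.hasMap.map π')
  let φ : Localization.Away f →ₐ[R] R := (P.P.lift a ha).comp P.equivRing.toAlgHom
  refine ⟨φ.comp (IsScalarTower.toAlgHom R S _), ?_⟩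
  have h : (Algebra.ofId R k).comp φ = π' := P.hom_ext (by simpa [φ, Algebra.ofId_apply] using hax)
  rw [← AlgHom.comp_assoc, h]
  ext s
  simp [π']

/-- If finitely many maximal ideals are separated by idempotents, then a ring surjects onto the
product of its localizations at maximal ideals. -/
theorem MaximalSpectrum.toPiLocalization_surjective_of_isIdempotentElem
    {A : Type*} [CommRing A] [Finite (MaximalSpectrum A)]
    (f : MaximalSpectrum A → A) (hf : ∀ m, IsIdempotentElem (f m))
    (hself : ∀ m, f m ∉ m.asIdeal) (hne : ∀ m m', m ≠ m' → f m ∈ m'.asIdeal) :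
    Function.Surjective (MaximalSpectrum.toPiLocalization A) := by
  classical
  have := Fintype.ofFinite (MaximalSpectrum A)
  have eq_one {m : MaximalSpectrum A} {e : A} (he : IsIdempotentElem e) (hem : e ∉ m.asIdeal) :
      algebraMap A (Localization.AtPrime m.asIdeal) e = 1 :=
    (IsIdempotentElem.iff_eq_one_of_isUnit
      (IsLocalization.map_units (M := m.asIdeal.primeCompl) _ ⟨e, hem⟩)).mp (he.map _)
  have hcompl {m : MaximalSpectrum A} {e : A} (hem : e ∈ m.asIdeal) : 1 - e ∉ m.asIdeal :=
    fun h ↦ m.isMaximal.ne_top <| (Ideal.eq_top_iff_one _).mpr <| by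
      simpa using add_mem h hem
  have eq_zero {m : MaximalSpectrum A} {e : A} (he : IsIdempotentElem e) (hem : e ∈ m.asIdeal) :
      algebraMap A (Localization.AtPrime m.asIdeal) e = 0 := by
    simpa using eq_one he.one_sub (hcompl hem)
  have hcompl' (m : MaximalSpectrum A) : 1 - f m ∈ m.asIdeal :=
    (m.isMaximal.isPrime.mem_or_mem (x := f m) (y := 1 - f m)
      (by simp [mul_sub, (hf m).eq])).resolve_left (hself m)
  intro x
  have key (m : MaximalSpectrum A) :
      ∃ b : A, algebraMap A (Localization.AtPrime m.asIdeal) (f m * b) = x m := by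
    obtain ⟨⟨a, s⟩, has⟩ := IsLocalization.surj m.asIdeal.primeCompl (x m)
    have hu : IsUnit (s * f m + (1 - f m)) := by
      by_contra hu
      obtain ⟨M, hM, huM⟩ := exists_max_ideal_of_mem_nonunits hu
      by_cases h : m = ⟨M, hM⟩
      · subst h
        exact (hM.isPrime.mem_or_mem
          ((Ideal.add_mem_iff_left M (hcompl' ⟨M, hM⟩)).mp huM)).elim s.2 (hself ⟨M, hM⟩)
      · have hfM := hne m ⟨M, hM⟩ h
        exact hcompl hfM ((Ideal.add_mem_iff_right _ (Ideal.mul_mem_left _ _ hfM)).mp huM)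
    obtain ⟨v, hv⟩ := hu.exists_right_inv
    refine ⟨a * v, ?_⟩
    have h1 := eq_one (hf m) (hself m)
    have hv' := congrArg (algebraMap A (Localization.AtPrime m.asIdeal)) hv
    simp only [map_mul, map_add, map_sub, map_one, h1, mul_one, sub_self, add_zero] at hv'
    rw [map_mul, h1, one_mul, map_mul, ← has, mul_assoc, hv', mul_one]
  choose b hb using key
  refine ⟨∑ m, f m * b m, funext fun m ↦ ?_⟩
  rw [toPiLocalization_apply_apply, map_sum, Finset.sum_eq_single m, hb]
  · intro m' _ h
    rw [map_mul, eq_zero (hf m') (hne m' m h), zero_mul]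
  · simp

/-- The maximal ideals of a finite algebra over a Henselian local ring are separated by
idempotents. -/
theorem exists_isIdempotentElem_forall_mem_iff_ne_of_henselian
    (R : Type*) {A : Type*} [CommRing R] [HenselianLocalRing R] [CommRing A]
    [Algebra R A] [Module.Finite R A] (m : MaximalSpectrum A) :
    ∃ f : A, IsIdempotentElem f ∧ ∀ m' : MaximalSpectrum A, f ∈ m'.asIdeal ↔ m ≠ m' := by
  obtain ⟨R', _, _, _, P, _, _, n, e, he, P', _, _, hP, -, H⟩ :=
    Algebra.exists_etale_completeOrthogonalIdempotents_forall_liesOver_eq (S := A)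
      (IsLocalRing.maximalIdeal R)
  have hk : Function.Surjective (algebraMap R P.ResidueField) := by
    have h := hP.2.comp (Ideal.algebraMap_residueField_surjective (IsLocalRing.maximalIdeal R))
    convert h using 1
    ext r
    simp [IsScalarTower.algebraMap_apply R R' P.ResidueField]
  obtain ⟨φ, hφ⟩ := Algebra.Etale.exists_algHom_of_henselian hk
    (IsScalarTower.toAlgHom R R' P.ResidueField)
  have hφP (r : R') : φ r ∈ IsLocalRing.maximalIdeal R ↔ r ∈ P := by
    rw [← IsLocalRing.ker_eq_maximalIdeal _ hk, RingHom.mem_ker,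
      ← Ideal.algebraMap_residueField_eq_zero (I := P)]
    exact Eq.congr_left (DFunLike.congr_fun hφ r)
  let ψ : R' ⊗[R] A →ₐ[R] A :=
    Algebra.TensorProduct.lift ((Algebra.ofId R A).comp φ) (.id R A) fun _ _ ↦ .all _ _
  have hψ : Function.Surjective ψ := fun a ↦ ⟨1 ⊗ₜ a, by simp [ψ]⟩
  have hlies (m' : MaximalSpectrum A) : (m'.asIdeal.comap ψ).LiesOver P := by
    refine ⟨Ideal.ext fun r ↦ ?_⟩
    have hm' : m'.asIdeal.comap (algebraMap R A) = IsLocalRing.maximalIdeal R :=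
      IsLocalRing.eq_maximalIdeal (Ideal.isMaximal_comap_of_isIntegral_of_isMaximal m'.asIdeal)
    rw [← hφP, ← hm']
    simp [Ideal.mem_comap, ψ, Algebra.ofId_apply]
  have hlast (m' : MaximalSpectrum A) : ψ (e (.last n)) ∈ m'.asIdeal :=
    (H (m'.asIdeal.comap ψ) inferInstance (hlies m')).1
  have huniq (m' : MaximalSpectrum A) (i : Fin n) (hi : ψ (e i.castSucc) ∉ m'.asIdeal) :
      m'.asIdeal.comap ψ = P' i :=
    (H (m'.asIdeal.comap ψ) inferInstance (hlies m')).2 i hi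
  have heψ := he.map (ψ : R' ⊗[R] A →+* A)
  obtain ⟨i, hi⟩ : ∃ i : Fin n, ψ (e i.castSucc) ∉ m.asIdeal := by
    by_contra! h
    refine m.isMaximal.ne_top ((Ideal.eq_top_iff_one _).mpr ?_)
    rw [← heψ.complete, Fin.sum_univ_castSucc]
    exact add_mem (sum_mem fun i _ ↦ h i) (hlast m)
  refine ⟨ψ (e i.castSucc), heψ.idem i.castSucc, fun m' ↦ ⟨?_, fun hne ↦ ?_⟩⟩
  · rintro h rfl
    exact hi h
  · by_contra h
    exact hne (MaximalSpectrum.ext (Ideal.comap_injective_of_surjective ψ hψ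
      ((huniq m i hi).trans (huniq m' i h).symm)))

/-- A finite algebra over a local ring has finitely many maximal ideals. -/
theorem MaximalSpectrum.finite_of_isLocalRing
    (R A : Type*) [CommRing R] [IsLocalRing R] [CommRing A] [Algebra R A] [Module.Finite R A] :
    Finite (MaximalSpectrum A) := by
  have : Finite ((IsLocalRing.maximalIdeal R).primesOver A) :=
    (Algebra.QuasiFinite.finite_primesOver _).to_subtype
  refine Finite.of_injective
    (fun m : MaximalSpectrum A ↦
      (⟨m.asIdeal, m.isMaximal.isPrime, ⟨(IsLocalRing.eq_maximalIdeal
        (Ideal.isMaximal_comap_of_isIntegral_of_isMaximal m.asIdeal)).symm⟩⟩ :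
        (IsLocalRing.maximalIdeal R).primesOver A)) fun m m' h ↦ ?_
  exact MaximalSpectrum.ext (congrArg Subtype.val h)


/-- A finite algebra `A` over a Henselian local ring `R` has finitely many
maximal ideals, and the canonical map from `A` to the product of its
localizations at maximal ideals is bijective; in particular `A` is a finite
product of local rings. -/
theorem finite_maximalSpectrum_and_bijective_toPiLocalization_of_henselian
    (R A : Type*) [CommRing R] [HenselianLocalRing R] [CommRing A]
    [Algebra R A] [Module.Finite R A] :
    Finite (MaximalSpectrum A) ∧
      Function.Bijective (fun (a : A) (m : MaximalSpectrum A) =>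
        algebraMap A (Localization.AtPrime m.asIdeal) a) := by
  have := MaximalSpectrum.finite_of_isLocalRing R A
  choose f hf hmem using
    exists_isIdempotentElem_forall_mem_iff_ne_of_henselian R (A := A)
  exact ⟨this, MaximalSpectrum.toPiLocalization_injective A,
    MaximalSpectrum.toPiLocalization_surjective_of_isIdempotentElem f hf
      (fun m h ↦ (hmem m m).mp h rfl) fun m m' ↦ (hmem m m').mpr⟩
end

section
/- Let k be a field and G a finite group with (card G : k) ≠ 0 in k. Let V be a nonzero finite-dimensional k-vector space with a representation ρ of G on V such that every k-linear endomorphism of V commuting with the action of G is a scalar multiple of the identity. Then the image of dim_k V in k is nonzero (the dimension of V is invertible in k). -/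
/-- If `G` is a finite group with order nonzero in a field `k`, and `V` is a
nonzero finite-dimensional representation of `G` over `k` such that every
`G`-equivariant endomorphism of `V` is scalar, then the dimension of `V` is
nonzero in `k`. -/
theorem finrank_ne_zero_in_field_of_schur
    (k : Type*) [Field k] (G : Type*) [Group G] [Finite G]
    (hG : (Nat.card G : k) ≠ 0)
    (V : Type*) [AddCommGroup V] [Module k V] [FiniteDimensional k V]
    [Nontrivial V]
    (ρ : G →* (V ≃ₗ[k] V))
    (hschur : ∀ f : V →ₗ[k] V, (∀ (g : G) (v : V), f (ρ g v) = ρ g (f v)) →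
      ∃ c : k, f = c • LinearMap.id) :
    (Module.finrank k V : k) ≠ 0 := by
  have := Fintype.ofFinite G
  intro hn
  obtain ⟨v, hv⟩ := exists_ne (0 : V)
  obtain ⟨φ, hφ⟩ := Module.Projective.exists_dual_ne_zero k hv
  obtain ⟨c, hc⟩ := hschur (∑ g : G, (ρ g).conj (φ.smulRight v)) fun h w => by
    simp only [LinearMap.sum_apply, map_sum]
    refine Fintype.sum_equiv (Equiv.mulLeft h⁻¹) _ _ fun g => ?_
    simp only [LinearEquiv.conj_apply_apply, Equiv.coe_mulLeft, map_mul, map_inv,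
      LinearEquiv.mul_apply, ← LinearEquiv.coe_inv, mul_inv_rev, inv_inv]
    exact (LinearEquiv.apply_symm_apply (ρ h) _).symm
  have htr := congrArg (LinearMap.trace k V) hc
  rw [map_sum, map_smul, LinearMap.trace_id, hn, smul_zero] at htr
  simp only [LinearMap.trace_conj', LinearMap.trace_smulRight, Finset.sum_const,
    Finset.card_univ, nsmul_eq_mul] at htr
  rw [Nat.card_eq_fintype_card] at hG
  exact mul_ne_zero hG hφ htr
end

section
/- Let R be a commutative ring and G a finite group whose order is invertible in R (i.e., (card G : R) is a unit). Let M be an R-module equipped with an R-linear action of G, let M^G denote the submodule of G-invariant elements, and let N be any R-module, regarded with the trivial G-action. Give M ⊗_R N the G-action determined by g•(m ⊗ n) = (g•m) ⊗ n. Then the canonical R-linear map M^G ⊗_R N → (M ⊗_R N)^G, induced by the inclusion M^G → M, is bijective. -/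
open TensorProduct

/-- The submodule of invariants of a module `M` under an `R`-linear action of
a group `G`. -/
def invariantSubmodule (G R M : Type*) [Group G] [CommRing R] [AddCommGroup M]
    [Module R M] [DistribMulAction G M] [SMulCommClass R G M] :
    Submodule R M where
  carrier := {m | ∀ g : G, g • m = m}
  add_mem' := fun ha hb g => by rw [smul_add, ha g, hb g]
  zero_mem' := fun g => smul_zero g
  smul_mem' := fun r m hm g => by rw [← smul_comm, hm g]

/-- The Reynolds operator `m ↦ c • ∑ g, g • m` onto the invariants. It is a projection when `c` is
inverse to the order of `G`. -/
def reynolds (G : Type*) {R : Type*} (M : Type*) [Group G] [Fintype G] [CommRing R]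
    [AddCommGroup M] [Module R M] [DistribMulAction G M] [SMulCommClass R G M] (c : R) :
    M →ₗ[R] invariantSubmodule G R M :=
  (c • ∑ g : G, ({ DistribSMul.toAddMonoidHom M g with
      map_smul' := fun r m => (smul_comm r g m).symm } : M →ₗ[R] M)).codRestrict _ fun m h => by
    simp only [LinearMap.smul_apply, LinearMap.sum_apply]
    rw [← smul_comm, Finset.smul_sum]
    congr 1
    exact Fintype.sum_equiv (Equiv.mulLeft h) _ _ fun g => smul_smul h g m

section Reynolds

variable {G R M N : Type*} [Group G] [Fintype G] [CommRing R] [AddCommGroup M] [Module R M]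
  [AddCommGroup N] [Module R N] [DistribMulAction G M] [SMulCommClass R G M]

theorem reynolds_apply (c : R) (m : M) : (reynolds G M c m : M) = c • ∑ g : G, g • m := by
  simp [reynolds]

theorem coe_reynolds_of_mem {c : R} (hc : c * (Fintype.card G : R) = 1) {m : M}
    (hm : m ∈ invariantSubmodule G R M) : (reynolds G M c m : M) = m := by
  have hm' : ∀ g : G, g • m = m := hm
  simp only [reynolds_apply, hm', Finset.sum_const, Finset.card_univ]
  rw [← Nat.cast_smul_eq_nsmul R, smul_smul, hc, one_smul]

theorem reynolds_comp_subtype {c : R} (hc : c * (Fintype.card G : R) = 1) :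
    reynolds G M c ∘ₗ (invariantSubmodule G R M).subtype = LinearMap.id :=
  LinearMap.ext fun m => Subtype.ext (coe_reynolds_of_mem hc m.2)

theorem map_subtype_comp_reynolds (c : R) :
    TensorProduct.map (invariantSubmodule G R M).subtype (LinearMap.id (M := N)) ∘ₗ
        TensorProduct.map (reynolds G M c) LinearMap.id =
      (invariantSubmodule G R (M ⊗[R] N)).subtype ∘ₗ reynolds G (M ⊗[R] N) c := by
  ext m n
  simp [reynolds_apply, TensorProduct.smul_tmul', ← TensorProduct.sum_tmul]

end Reynolds

/-- If the order of a finite group `G` is invertible in `R`, then for an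
`R`-module `M` with an `R`-linear `G`-action and any `R`-module `N` (with
trivial `G`-action, so that `g • (m ⊗ n) = (g • m) ⊗ n` on `M ⊗[R] N`), the
canonical map `M^G ⊗[R] N → (M ⊗[R] N)^G` induced by the inclusion `M^G → M`
is bijective: it is injective with range the invariants of `M ⊗[R] N`. -/
theorem invariants_tensor_bijective
    (R : Type*) [CommRing R] (G : Type*) [Group G] [Finite G]
    (hG : IsUnit (Nat.card G : R))
    (M N : Type*) [AddCommGroup M] [Module R M] [AddCommGroup N] [Module R N]
    [DistribMulAction G M] [SMulCommClass R G M] :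
    Function.Injective
        (TensorProduct.map (invariantSubmodule G R M).subtype
          (LinearMap.id (M := N))) ∧
      LinearMap.range
          (TensorProduct.map (invariantSubmodule G R M).subtype
            (LinearMap.id (M := N))) =
        invariantSubmodule G R (M ⊗[R] N) := by
  cases nonempty_fintype G
  obtain ⟨c, hc⟩ := hG.exists_left_inv
  rw [Nat.card_eq_fintype_card] at hc
  refine ⟨Function.LeftInverse.injective
    (g := TensorProduct.map (reynolds G M c) LinearMap.id) fun x => ?_, le_antisymm ?_ ?_⟩
  · rw [← LinearMap.comp_apply, ← TensorProduct.map_comp, reynolds_comp_subtype hc]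
    simp
  · rintro _ ⟨x, rfl⟩
    induction x with
    | zero => simp
    | add x y hx hy => simpa only [map_add] using add_mem hx hy
    | tmul m n =>
      intro g
      simp only [TensorProduct.map_tmul, TensorProduct.smul_tmul', Submodule.subtype_apply]
      rw [m.2 g]
  · intro x hx
    refine ⟨TensorProduct.map (reynolds G M c) LinearMap.id x, ?_⟩
    rw [← LinearMap.comp_apply, map_subtype_comp_reynolds]
    exact coe_reynolds_of_mem hc hx
end

section
/- Let k be an algebraically closed field, G a finite group with (card G : k) ≠ 0 in k, and H a normal abelian subgroup of G whose index in G is a prime number p. Let V be a nonzero finite-dimensional k-vector space with an irreducible representation ρ of G on V. Then either there exists a group homomorphism χ : H → kˣ such that ρ(h) = χ(h)·id_V for every h ∈ H (i.e., H acts on V by scalars), or dim_k V = p. -/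
open Module in
/-- A commuting family of semisimple endomorphisms of a nonzero finite-dimensional vector space
over an algebraically closed field has a common eigenvector. -/
theorem exists_common_eigenvector_of_commute_of_isSemisimple
    {k V ι : Type*} [Field k] [IsAlgClosed k] [AddCommGroup V] [Module k V]
    [FiniteDimensional k V] [Nontrivial V] (f : ι → End k V)
    (hcomm : ∀ i j, Commute (f i) (f j)) (hss : ∀ i, (f i).IsSemisimple) :
    ∃ (χ : ι → k) (v : V), v ≠ 0 ∧ ∀ i, f i v = χ i • v := by
  have htop := End.iSup_iInf_maxGenEigenspace_eq_top_of_iSup_maxGenEigenspace_eq_top_of_commute f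
    (fun i j _ ↦ hcomm i j) (fun i ↦ End.iSup_maxGenEigenspace_eq_top (f i))
  obtain ⟨χ, hχ⟩ : ∃ χ : ι → k, ⨅ i, (f i).maxGenEigenspace (χ i) ≠ ⊥ := by
    by_contra! h
    simp [h] at htop
  obtain ⟨v, hv, hv0⟩ := Submodule.exists_mem_ne_zero_of_ne_bot hχ
  refine ⟨χ, v, hv0, fun i ↦ ?_⟩
  have hvi := (Submodule.mem_iInf _).mp hv i
  rwa [(hss i).isFinitelySemisimple.maxGenEigenspace_eq_eigenspace, End.mem_eigenspace_iff] at hvi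

open Module in
/-- Common eigenvectors of a commuting family with distinct systems of eigenvalues are linearly
independent. -/
theorem linearIndependent_of_common_eigenvectors
    {k V ι α : Type*} [Field k] [AddCommGroup V] [Module k V] (f : ι → End k V)
    (hcomm : ∀ i j, Commute (f i) (f j)) (χ : α → ι → k) (hχ : Function.Injective χ)
    (v : α → V) (hv0 : ∀ a, v a ≠ 0) (hv : ∀ a i, f i (v a) = χ a i • v a) :
    LinearIndependent k v := by
  have hind := End.independent_iInf_maxGenEigenspace_of_forall_mapsTo f
    (fun i j ↦ End.mapsTo_maxGenEigenspace_of_comm (hcomm j i))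
  refine (hind.comp hχ).linearIndependent _ (fun a ↦ ?_) hv0
  refine (Submodule.mem_iInf _).mpr fun i ↦ ?_
  exact End.genEigenspace_le_maximal _ _ 1 (End.mem_eigenspace_iff.mpr (hv a i))

open Module Polynomial in
theorem Module.End.isSemisimple_of_pow_eq_one
    {k V : Type*} [Field k] [AddCommGroup V] [Module k V] {f : End k V} {n : ℕ}
    (hn : (n : k) ≠ 0) (hf : f ^ n = 1) : f.IsSemisimple :=
  End.isSemisimple_of_squarefree_aeval_eq_zero (X_pow_sub_one_separable_iff.mpr hn).squarefree
    (by simp [hf])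

theorem Subgroup.eq_or_eq_top_of_le_of_prime_index {G : Type*} [Group G] {H S : Subgroup G}
    (hle : H ≤ S) (hp : H.index.Prime) : S = H ∨ S = ⊤ := by
  have hmul := Subgroup.relIndex_mul_index hle
  rcases (Nat.dvd_prime hp).mp (Subgroup.index_dvd_of_le hle) with h | h
  · exact .inr (Subgroup.index_eq_one.mp h)
  · rw [h] at hmul
    exact .inl (le_antisymm
      (Subgroup.relIndex_eq_one.mp ((mul_eq_right₀ hp.ne_zero).mp hmul)) hle)

/-- The elements of `G` fixing a function on a normal subgroup under conjugation. -/
def Subgroup.conjStabilizer {G α : Type*} [Group G] (H : Subgroup G) [H.Normal] (χ : H → α) :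
    Subgroup G where
  carrier := {g | ∀ h, χ (MulAut.conjNormal g h) = χ h}
  one_mem' := by simp
  mul_mem' := fun {a b} ha hb h ↦ by
    rw [map_mul, MulAut.mul_apply, ha, hb]
  inv_mem' := fun {a} ha h ↦ by
    rw [← ha, ← MulAut.mul_apply, ← map_mul]
    simp

/-- If a common eigenvector of a subgroup has eigenvalues `χ`, then `χ` is a character. -/
theorem exists_monoidHom_of_eigenvector {k H V : Type*} [Field k] [Group H] [AddCommGroup V]
    [Module k V] (ρ : H →* (V ≃ₗ[k] V)) {χ : H → k} {v : V} (hv0 : v ≠ 0)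
    (hv : ∀ h, ρ h v = χ h • v) : ∃ ψ : H →* kˣ, ∀ h, (ψ h : k) = χ h := by
  let φ : H →* k :=
    { toFun := χ
      map_one' := smul_left_injective k hv0 (by simp [← hv])
      map_mul' := fun a b ↦ smul_left_injective k hv0 (by
        simp only [← hv, map_mul, LinearEquiv.mul_apply]
        rw [hv b, map_smul, hv a, smul_smul, mul_comm]) }
  exact ⟨φ.toHomUnits, fun h ↦ rfl⟩


/-- Let `k` be algebraically closed, `G` a finite group of order nonzero in
`k`, and `H` a normal abelian subgroup of prime index `p`. Then any
irreducible representation of `G` over `k` either restricts to scalars on `H`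
or has dimension `p`. -/
theorem scalar_on_subgroup_or_finrank_eq_prime_index
    (k : Type*) [Field k] [IsAlgClosed k]
    (G : Type*) [Group G] [Finite G] (hG : (Nat.card G : k) ≠ 0)
    (H : Subgroup G) [H.Normal]
    (habel : ∀ a b : G, a ∈ H → b ∈ H → a * b = b * a)
    (p : ℕ) (hp : p.Prime) (hind : H.index = p)
    (V : Type*) [AddCommGroup V] [Module k V] [FiniteDimensional k V]
    [Nontrivial V]
    (ρ : G →* (V ≃ₗ[k] V))
    (hirr : ∀ W : Submodule k V, (∀ (g : G), ∀ v ∈ W, ρ g v ∈ W) →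
      W = ⊥ ∨ W = ⊤) :
    (∃ χ : H →* kˣ, ∀ (h : H) (v : V), ρ (h : G) v = (χ h : k) • v) ∨
      Module.finrank k V = p := by
  let f : H → Module.End k V := fun h ↦ (ρ h : V →ₗ[k] V)
  have hcomm (a b : H) : Commute (f a) (f b) := by
    ext v
    change ρ a (ρ b v) = ρ b (ρ a v)
    rw [← LinearEquiv.mul_apply, ← LinearEquiv.mul_apply, ← map_mul, ← map_mul,
      habel a b a.2 b.2]
  have hss (h : H) : (f h).IsSemisimple := by
    refine Module.End.isSemisimple_of_pow_eq_one hG ?_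
    have hpow (n : ℕ) : f h ^ n = f (h ^ n) := by
      induction n with
      | zero => ext v; simp [f]
      | succ n ih => ext v; simp [pow_succ, ih, f]
    ext v
    rw [hpow]
    simp [f]
  obtain ⟨χ, v, hv0, hv⟩ := exists_common_eigenvector_of_commute_of_isSemisimple f hcomm hss
  replace hv (h : H) : ρ h v = χ h • v := hv h
  have hρ (a b : G) (w : V) : ρ a (ρ b w) = ρ (a * b) w := by simp
  rcases Subgroup.eq_or_eq_top_of_le_of_prime_index (S := H.conjStabilizer χ)
    (fun g hg h ↦ congrArg χ (Subtype.ext (by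
      rw [MulAut.conjNormal_apply, habel g h hg h.2, mul_inv_cancel_right])))
    (hind ▸ hp) with hS | hS
  · right
    have hmove (g : G) (h : H) :
        ρ h (ρ g v) = χ (MulAut.conjNormal g⁻¹ h) • ρ g v := by
      rw [← map_smul, ← hv, hρ, hρ]
      simp [mul_assoc]
    have hli : LinearIndependent k fun q : G ⧸ H ↦ ρ q.out v := by
      refine linearIndependent_of_common_eigenvectors f hcomm
        (fun q h ↦ χ (MulAut.conjNormal q.out⁻¹ h)) (fun q r hqr ↦ ?_) _
        (fun q ↦ (map_ne_zero_iff _ (ρ _).injective).mpr hv0) (fun q h ↦ hmove _ h)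
      have hmem : r.out⁻¹ * q.out ∈ H.conjStabilizer χ := fun h ↦ by
        have := congrFun hqr (MulAut.conjNormal q.out h)
        simp only [← MulAut.mul_apply, ← map_mul] at this
        simpa using this.symm
      rw [hS] at hmem
      simpa using (QuotientGroup.eq.mpr hmem).symm
    have hspan : Submodule.span k (Set.range fun q : G ⧸ H ↦ ρ q.out v) = ⊤ := by
      refine (hirr _ fun g w hw ↦ ?_).resolve_left fun hbot ↦ ?_
      · induction hw using Submodule.span_induction with
        | mem w hw =>
          obtain ⟨q, rfl⟩ := hw
          obtain ⟨h, hh⟩ := QuotientGroup.mk_out_eq_mul H (g * q.out)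
          have hg : g * q.out = (QuotientGroup.mk (g * q.out) : G ⧸ H).out * (h⁻¹ : H) := by
            rw [hh, Subgroup.coe_inv, mul_inv_cancel_right]
          change ρ g (ρ q.out v) ∈ _
          rw [hρ, congrArg ρ hg, ← hρ, hv, map_smul]
          exact Submodule.smul_mem _ _ (Submodule.subset_span ⟨_, rfl⟩)
        | zero => simp
        | add x y _ _ hx hy => rw [map_add]; exact add_mem hx hy
        | smul c x _ hx => rw [map_smul]; exact Submodule.smul_mem _ _ hx
      · rw [Submodule.span_eq_bot] at hbot
        exact hv0 ((map_eq_zero_iff _ (ρ _).injective).mp (hbot _ ⟨QuotientGroup.mk 1, rfl⟩))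
    rw [Module.finrank_eq_nat_card_basis (Module.Basis.mk hli hspan.ge), ← hind]
    rfl
  · left
    obtain ⟨ψ, hψ⟩ := exists_monoidHom_of_eigenvector (ρ.comp H.subtype) hv0 hv
    refine ⟨ψ, fun h w ↦ ?_⟩
    let W : Submodule k V := ⨅ h, (f h).eigenspace (χ h)
    have hW (w : V) : w ∈ W ↔ ∀ h : H, ρ h w = χ h • w := by
      simp [W, f]
    have hWtop : W = ⊤ := by
      refine (hirr W fun g w hw ↦ ?_).resolve_left fun hbot ↦ ?_
      · rw [hW] at hw ⊢
        intro h
        have hg : g⁻¹ ∈ H.conjStabilizer χ := hS ▸ Subgroup.mem_top _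
        rw [← map_smul, ← hg h, ← hw, hρ, hρ]
        simp [mul_assoc]
      · exact hv0 ((Submodule.eq_bot_iff W).mp hbot v ((hW v).mpr hv))
    rw [hψ]
    exact (hW w).mp (hWtop ▸ Submodule.mem_top) h
end

section
/- Let R be a commutative ring and G a finite group whose order is invertible in R. Let A be a commutative R-algebra that is a free R-module of rank equal to card G, equipped with an action of G by R-algebra automorphisms such that the invariant subalgebra A^G equals the image of the structure map R → A (i.e., A^G = R·1). Then for every a ∈ A one has Tr_{A/R}(a)·1_A = Σ_{g ∈ G} g•a, where Tr_{A/R}(a) denotes the trace of the R-linear endomorphism of A given by multiplication by a. -/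
/-- If a finite group `G` of order invertible in `R` acts by `R`-algebra
automorphisms on a commutative `R`-algebra `A` that is free of rank `card G`
as an `R`-module, with invariants exactly the image of `R`, then the trace of
multiplication by any `a : A` equals the sum of the `G`-orbit of `a`. -/
theorem trace_eq_sum_orbit_of_invariants_eq_bot
    (R : Type*) [CommRing R] (G : Type*) [Group G] [Fintype G]
    (hG : IsUnit (Fintype.card G : R))
    (A : Type*) [CommRing A] [Algebra R A] [Module.Free R A] [Module.Finite R A]
    (hrank : Module.finrank R A = Fintype.card G)
    [MulSemiringAction G A] [SMulCommClass R G A]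
    (hinv : {a : A | ∀ g : G, g • a = a} = Set.range (algebraMap R A)) :
    ∀ a : A, algebraMap R A (Algebra.trace R A a) = ∑ g : G, g • a := by
  intro a
  have hmem : ∑ g : G, g • a ∈ {a : A | ∀ g : G, g • a = a} := fun h => by
    simp_rw [Finset.smul_sum, smul_smul]
    exact Fintype.sum_equiv (Equiv.mulLeft h) _ _ fun _ => rfl
  rw [hinv] at hmem
  obtain ⟨r, hr⟩ := hmem
  rw [← hr]
  congr 1
  have : SMulCommClass G R A := SMulCommClass.symm R G A
  have htrace (g : G) : Algebra.trace R A (g • a) = Algebra.trace R A a :=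
    Algebra.trace_eq_of_algEquiv (MulSemiringAction.toAlgEquiv R A g) a
  nontriviality R
  have hsum := congrArg (Algebra.trace R A) hr
  rw [Algebra.trace_algebraMap, hrank, map_sum] at hsum
  simp only [htrace, Finset.sum_const, Finset.card_univ, nsmul_eq_mul] at hsum
  exact (hG.mul_left_cancel hsum).symm
end

section
/- Let R be an integral domain with fraction field K, and let A be a commutative R-algebra that is a free R-module of finite rank n. Let G be a finite group acting faithfully on A by R-algebra automorphisms such that the invariant subalgebra A^G equals the image of the structure map R → A. Assume that A ⊗_R K is a field. Then n = card G. -/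
open TensorProduct

/-- Let `R` be a domain with fraction field `K` and `A` a commutative
`R`-algebra, free of finite rank as an `R`-module, with a faithful action of a
finite group `G` by `R`-algebra automorphisms such that the invariants are
exactly the image of `R`. If the generic fiber `A ⊗[R] K` is a field, then
the rank of `A` equals the order of `G`. -/
theorem finrank_eq_card_of_faithful_of_generic_fiber_field
    (R : Type*) [CommRing R] [IsDomain R]
    (K : Type*) [Field K] [Algebra R K] [IsFractionRing R K]
    (A : Type*) [CommRing A] [Algebra R A] [Module.Free R A] [Module.Finite R A]
    (G : Type*) [Group G] [Finite G] [MulSemiringAction G A] [SMulCommClass R G A]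
    [FaithfulSMul G A]
    (hinv : {a : A | ∀ g : G, g • a = a} = Set.range (algebraMap R A))
    (hfield : IsField (A ⊗[R] K)) :
    Module.finrank R A = Nat.card G := by
  have : Nontrivial (A ⊗[R] K) := hfield.nontrivial
  have : IsDomain (A ⊗[R] K) := hfield.isDomain
  have hinj : Function.Injective (algebraMap A (A ⊗[R] K)) :=
    Algebra.TensorProduct.includeLeft_injective (S := A) (IsFractionRing.injective R K)
  have : IsDomain A := hinj.isDomain (algebraMap A (A ⊗[R] K))
  have : IsGaloisGroup G R A :=
    { faithful := inferInstance
      commutes := SMulCommClass.symm R G A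
      isInvariant := ⟨fun a ha ↦ hinv.subset ha⟩ }
  exact (IsGaloisGroup.card_eq_finrank' G R A).symm
end
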